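/- Let r be a positive integer and let α, β, γ > 0 be real numbers such that 2β < (1 − α/2)² and γ ≥ (1 − α/2) − √((1 − α/2)² − 2β). Then every (r,β,γ)-dense digraph D with maximum out-degree at most r, maximum in-degree at most r, and c(D) < αr satisfies v(D) ≥ ((1 − α/2) + √((1 − α/2)² − 2β))·r. -/

import Mathlib

/-- A digraph: a finite vertex set together with a set of arcs (no loops). -/
structure FinDigraph (V : Type) [DecidableEq V] where
  verts : Finset V
  arcs : Finset (V × V)
  mem_of_arc : ∀ a ∈ arcs, a.1 ∈ verts ∧ a.2 ∈ verts
  ne_of_arc : ∀ a ∈ arcs, a.1 ≠ a.2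

namespace FinDigraph

variable {V : Type} [DecidableEq V]

/-- A directed cycle, represented as the list of its (distinct) vertices:
at least two vertices, consecutive vertices form arcs, and there is an arc
from the last vertex back to the first. -/
def IsCycle (D : FinDigraph V) (C : List V) : Prop :=
  C.Nodup ∧ 2 ≤ C.length ∧ C.Chain' (fun a b => (a, b) ∈ D.arcs) ∧
    ∀ h : C ≠ [], (C.getLast h, C.head h) ∈ D.arcs

/-- `D` contains a collection of `k` openly disjoint directed cycles through a vertex. -/
def HasOpenCycles (D : FinDigraph V) (k : ℕ) : Prop :=
  ∃ (v : V) (C : Fin k → List V), v ∈ D.verts ∧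
    (∀ i, D.IsCycle (C i) ∧ v ∈ C i) ∧
    ∀ i j, i ≠ j → Disjoint ((C i).toFinset \ {v}) ((C j).toFinset \ {v})

/-- `c(D)`: the largest `k` such that `D` contains `k` openly disjoint cycles through
a vertex. -/
noncomputable def cNum (D : FinDigraph V) : ℕ := sSup {k | D.HasOpenCycles k}

/-- The out-degree of a vertex. -/
def outDeg (D : FinDigraph V) (v : V) : ℕ := (D.arcs.filter fun a => a.1 = v).card

/-- The in-degree of a vertex. -/
def inDeg (D : FinDigraph V) (v : V) : ℕ := (D.arcs.filter fun a => a.2 = v).card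

/-- A digraph is `r`-regular if it is nonempty and every vertex has out- and in-degree
exactly `r`. -/
def IsRegular (D : FinDigraph V) (r : ℕ) : Prop :=
  D.verts.Nonempty ∧ ∀ v ∈ D.verts, D.outDeg v = r ∧ D.inDeg v = r

end FinDigraph

namespace FinDigraph

variable {V : Type} [DecidableEq V]

/-- A digraph `D` is `(r,β,γ)`-dense if `v(D) ≥ γr` and `a(D) ≥ r·v(D) − βr²`. -/
def IsDense (D : FinDigraph V) (r : ℕ) (β γ : ℝ) : Prop :=
  γ * r ≤ (D.verts.card : ℝ) ∧ (r : ℝ) * D.verts.card - β * r ^ 2 ≤ (D.arcs.card : ℝ)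

end FinDigraph

namespace FinDigraph

/-- Every directed cycle has a vertex of the digraph other than a prescribed one. -/
theorem IsCycle.exists_mem_ne {V : Type} [DecidableEq V] {D : FinDigraph V} {C : List V}
    (hC : D.IsCycle C) (v : V) : ∃ u ∈ D.verts, u ∈ C ∧ u ≠ v := by
  obtain ⟨hnd, hlen, hch, -⟩ := hC
  match C, hnd, hlen, hch with
  | a :: b :: l, hnd, _, hch =>
    have hab : (a, b) ∈ D.arcs := (List.isChain_cons_cons.1 hch).1
    by_cases hav : a = v
    · exact ⟨b, (D.mem_of_arc _ hab).2, by simp, fun h => D.ne_of_arc _ hab (hav.trans h.symm)⟩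
    · exact ⟨a, (D.mem_of_arc _ hab).1, by simp, hav⟩

theorem HasOpenCycles.le_card_verts {V : Type} [DecidableEq V] {D : FinDigraph V} {k : ℕ}
    (h : D.HasOpenCycles k) : k ≤ D.verts.card := by
  obtain ⟨v, C, -, hC, hdisj⟩ := h
  choose f hf hfC hfv using fun i => (hC i).1.exists_mem_ne v
  have hinj : Function.Injective f := by
    intro i j hij
    by_contra hne
    have hi : f i ∈ (C i).toFinset \ {v} := by simp [hfC i, hfv i]
    have hj : f i ∈ (C j).toFinset \ {v} := by simp [hij, hfC j, hfv j]
    exact Finset.disjoint_left.1 (hdisj i j hne) hi hj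
  simpa using Finset.card_le_card_of_injOn (s := Finset.univ) f (fun i _ => hf i) hinj.injOn

theorem HasOpenCycles.le_cNum {V : Type} [DecidableEq V] {D : FinDigraph V} {k : ℕ}
    (h : D.HasOpenCycles k) : k ≤ D.cNum :=
  le_csSup ⟨D.verts.card, fun _ hk => hk.le_card_verts⟩ h

/-- The arcs of `D` whose reversal is also an arc. -/
def digonArcs {V : Type} [DecidableEq V] (D : FinDigraph V) : Finset (V × V) :=
  D.arcs ∩ D.arcs.map (Equiv.prodComm V V).toEmbedding

theorem mem_digonArcs {V : Type} [DecidableEq V] {D : FinDigraph V} {u v : V} :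
    (u, v) ∈ D.digonArcs ↔ (u, v) ∈ D.arcs ∧ (v, u) ∈ D.arcs := by
  simp [digonArcs]

/-- The digons through a vertex are openly disjoint cycles. -/
theorem card_filter_digonArcs_le_cNum {V : Type} [DecidableEq V] (D : FinDigraph V) {v : V}
    (hv : v ∈ D.verts) : (D.digonArcs.filter fun a => a.1 = v).card ≤ D.cNum := by
  set s := D.digonArcs.filter fun a => a.1 = v
  have hs : ∀ a ∈ s, (v, a.2) ∈ D.arcs ∧ (a.2, v) ∈ D.arcs := by
    rintro ⟨x, y⟩ ha
    obtain ⟨hxy, hx : x = v⟩ := Finset.mem_filter.1 ha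
    exact mem_digonArcs.1 (hx ▸ hxy)
  apply HasOpenCycles.le_cNum
  refine ⟨v, fun i => [v, (s.equivFin.symm i).1.2], hv, fun i => ?_, fun i j hij => ?_⟩
  · obtain ⟨h₁, h₂⟩ := hs _ (s.equivFin.symm i).2
    have hne := D.ne_of_arc _ h₁
    refine ⟨⟨?_, ?_, ?_, ?_⟩, ?_⟩
    · simpa using hne
    · simp
    · exact List.isChain_pair.2 h₁
    · intro _
      exact h₂
    · simp
  · have hne : (s.equivFin.symm i).1.2 ≠ (s.equivFin.symm j).1.2 := by
      intro h
      refine hij (s.equivFin.symm.injective (Subtype.ext (Prod.ext ?_ h)))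
      rw [(Finset.mem_filter.1 (s.equivFin.symm i).2).2,
        (Finset.mem_filter.1 (s.equivFin.symm j).2).2]
    rw [Finset.disjoint_left]
    intro x hx hx'
    simp only [List.toFinset_cons, List.toFinset_nil, Finset.mem_sdiff, Finset.mem_insert,
      Finset.mem_singleton, Finset.notMem_empty, or_false] at hx hx'
    exact hne ((hx.1.resolve_left hx.2).symm.trans (hx'.1.resolve_left hx'.2))

theorem card_digonArcs_le {V : Type} [DecidableEq V] (D : FinDigraph V) :
    D.digonArcs.card ≤ D.cNum * D.verts.card :=
  Finset.card_le_mul_card_image_of_maps_to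
    (fun a ha => (D.mem_of_arc a (Finset.mem_inter.1 ha).1).1) _
    fun _ hv => D.card_filter_digonArcs_le_cNum hv

theorem two_mul_card_arcs_add_card_verts_le {V : Type} [DecidableEq V] (D : FinDigraph V) :
    2 * D.arcs.card + D.verts.card ≤ D.verts.card * D.verts.card + D.cNum * D.verts.card := by
  have hsub : D.arcs ∪ D.arcs.map (Equiv.prodComm V V).toEmbedding ⊆ D.verts.offDiag := by
    rintro ⟨x, y⟩ h
    rw [Finset.mem_offDiag]
    rcases Finset.mem_union.1 h with h | h
    · exact ⟨(D.mem_of_arc _ h).1, (D.mem_of_arc _ h).2, D.ne_of_arc _ h⟩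
    · have h : (y, x) ∈ D.arcs := by simpa using h
      exact ⟨(D.mem_of_arc _ h).2, (D.mem_of_arc _ h).1, (D.ne_of_arc _ h).symm⟩
  have hcard := Finset.card_le_card hsub
  have hunion := Finset.card_union_add_card_inter D.arcs
    (D.arcs.map (Equiv.prodComm V V).toEmbedding)
  have hdigon := D.card_digonArcs_le
  rw [Finset.card_map] at hunion
  rw [Finset.offDiag_card] at hcard
  have hself := Nat.le_mul_self D.verts.card
  unfold digonArcs at hdigon
  omega

end FinDigraph

/-- Let `r` be a positive integer and `α, β, γ > 0` reals with
`2β < (1 − α/2)²` and `γ ≥ (1 − α/2) − √((1 − α/2)² − 2β)`. Then every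
`(r,β,γ)`-dense digraph `D` with maximum out- and in-degree at most `r` and
`c(D) < αr` satisfies `v(D) ≥ ((1 − α/2) + √((1 − α/2)² − 2β))·r`. -/
theorem verts_lower_bound_of_dense {V : Type} [DecidableEq V]
    (r : ℕ) (hr : 1 ≤ r) (α β γ : ℝ) (hα : 0 < α) (hβ : 0 < β) (hγ : 0 < γ)
    (h1 : 2 * β < (1 - α / 2) ^ 2)
    (h2 : (1 - α / 2) - Real.sqrt ((1 - α / 2) ^ 2 - 2 * β) ≤ γ)
    (D : FinDigraph V) (hD : D.IsDense r β γ)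
    (hout : ∀ v, D.outDeg v ≤ r) (hin : ∀ v, D.inDeg v ≤ r)
    (hc : (D.cNum : ℝ) < α * r) :
    ((1 - α / 2) + Real.sqrt ((1 - α / 2) ^ 2 - 2 * β)) * r ≤ (D.verts.card : ℝ) := by
  have hr' : (0 : ℝ) < r := by exact_mod_cast hr
  obtain ⟨hn, ha⟩ := hD
  have hn0 : (0 : ℝ) < D.verts.card := (mul_pos hγ hr').trans_le hn
  have hcount : (2 * D.arcs.card + D.verts.card : ℝ) ≤
      D.verts.card * D.verts.card + D.cNum * D.verts.card := by
    exact_mod_cast D.two_mul_card_arcs_add_card_verts_le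
  set n : ℝ := (D.verts.card : ℝ)
  set t := Real.sqrt ((1 - α / 2) ^ 2 - 2 * β)
  have ht : t ^ 2 = (1 - α / 2) ^ 2 - 2 * β := Real.sq_sqrt (by linarith)
  have hlow : 0 ≤ n - (1 - α / 2 - t) * r := by
    linarith [mul_le_mul_of_nonneg_right h2 hr'.le]
  have hcn := mul_lt_mul_of_pos_right hc hn0
  have hquad : 0 < (n - (1 - α / 2 - t) * r) * (n - (1 - α / 2 + t) * r) := by
    linear_combination hcount + 2 * ha + hcn + hn0 + (r : ℝ) ^ 2 * ht
  linarith [pos_of_mul_pos_right hquad hlow]
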